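/- arXiv:1506.04879 — 2 statements merged into one kernel-verified Lean document; each statement's English description precedes it below -/
import Mathlib

section
/- If γ = γ₁ ∪ γ₂ is a finite set of interactions such that Act(γ₁) ∩ Act(γ₂) = ∅, then for every history-clock valuation h : A → ℝ, ℰ(γ)(h) holds if and only if ℰ(γ₁)(h) and ℰ(γ₂)(h) both hold. -/
variable {A : Type*} [DecidableEq A]

/-- The set of actions involved in a set of interactions. -/
def Act (γ : Finset (Finset A)) : Finset A := γ.sup id

/-- `γ ⊖ α`: eliminate from every interaction of `γ` the actions of `α`. -/
def ominus (γ : Finset (Finset A)) (α : Finset A) : Finset (Finset A) :=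
  (γ.filter (fun β => ¬ β ⊆ α)).image (fun β => β \ α)

lemma ominus_card_lt {γ : Finset (Finset A)} {α : Finset A} (hα : α ∈ γ) :
    (ominus γ α).card < γ.card := by
  calc (ominus γ α).card ≤ (γ.filter (fun β => ¬ β ⊆ α)).card := Finset.card_image_le
    _ ≤ (γ.erase α).card := Finset.card_le_card (by
        intro β hβ
        rw [Finset.mem_filter] at hβ
        exact Finset.mem_erase.mpr ⟨fun h => hβ.2 (h ▸ Finset.Subset.refl α), hβ.1⟩)
    _ < γ.card := Finset.card_erase_lt_of_mem hα

/-- The interaction inequalities `ℰ(γ)` on history clocks. -/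
def IE (γ : Finset (Finset A)) (h : A → ℝ) : Prop :=
  γ = ∅ ∨ ∃ α, ∃ _ : α ∈ γ,
    (∀ ai ∈ α, ∀ aj ∈ α, h ai = h aj) ∧
    (∀ ai ∈ α, ∀ ak ∈ Act (ominus γ α), h ai ≤ h ak) ∧
    IE (ominus γ α) h
termination_by γ.card
decreasing_by exact ominus_card_lt (by assumption)

lemma mem_Act_iff {γ : Finset (Finset A)} {a : A} : a ∈ Act γ ↔ ∃ β ∈ γ, a ∈ β := by
  simp [Act, Finset.mem_sup]

lemma mem_ominus_iff {γ : Finset (Finset A)} {α δ : Finset A} :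
    δ ∈ ominus γ α ↔ ∃ β ∈ γ, ¬ β ⊆ α ∧ β \ α = δ := by
  simp [ominus, and_assoc]

lemma ominus_union_eq {γ₁ γ₂ : Finset (Finset A)} {α : Finset A}
    (hγ₂ : ∀ β ∈ γ₂, β.Nonempty)
    (hd : ∀ a, a ∈ Act γ₁ → a ∉ Act γ₂) (hα : α ∈ γ₁) :
    ominus (γ₁ ∪ γ₂) α = ominus γ₁ α ∪ γ₂ := by
  have key : ∀ β ∈ γ₂, β \ α = β := by
    intro β hβ
    rw [Finset.sdiff_eq_self_iff_disjoint, Finset.disjoint_left]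
    intro a ha ha'
    exact hd a (mem_Act_iff.2 ⟨α, hα, ha'⟩) (mem_Act_iff.2 ⟨β, hβ, ha⟩)
  have key2 : ∀ β ∈ γ₂, ¬ β ⊆ α := by
    intro β hβ hs
    have h1 := key β hβ
    rw [Finset.sdiff_eq_empty_iff_subset.2 hs] at h1
    exact (hγ₂ β hβ).ne_empty h1.symm
  ext δ
  simp only [mem_ominus_iff, Finset.mem_union]
  constructor
  · rintro ⟨β, hβ | hβ, h1, h2⟩
    · exact Or.inl ⟨β, hβ, h1, h2⟩
    · right
      rw [← h2, key β hβ]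
      exact hβ
  · rintro (⟨β, hβ, h1, h2⟩ | hδ)
    · exact ⟨β, Or.inl hβ, h1, h2⟩
    · exact ⟨δ, Or.inr hδ, key2 δ hδ, key δ hδ⟩

lemma Act_ominus_sub {γ : Finset (Finset A)} {α : Finset A} {a : A}
    (ha : a ∈ Act (ominus γ α)) : a ∈ Act γ := by
  obtain ⟨δ, hδ, ha⟩ := mem_Act_iff.1 ha
  obtain ⟨β, hβ, -, rfl⟩ := mem_ominus_iff.1 hδ
  exact mem_Act_iff.2 ⟨β, hβ, (Finset.mem_sdiff.1 ha).1⟩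

lemma Act_cases {γ : Finset (Finset A)} {α : Finset A} {a : A}
    (ha : a ∈ Act γ) : a ∈ α ∨ a ∈ Act (ominus γ α) := by
  by_cases h : a ∈ α
  · exact Or.inl h
  · obtain ⟨β, hβ, hb⟩ := mem_Act_iff.1 ha
    exact Or.inr (mem_Act_iff.2 ⟨β \ α, mem_ominus_iff.2 ⟨β, hβ, fun hs => h (hs hb), rfl⟩,
      Finset.mem_sdiff.2 ⟨hb, h⟩⟩)

lemma Act_union_iff {γ₁ γ₂ : Finset (Finset A)} {a : A} :
    a ∈ Act (γ₁ ∪ γ₂) ↔ a ∈ Act γ₁ ∨ a ∈ Act γ₂ := by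
  simp only [mem_Act_iff, Finset.mem_union, or_and_right, exists_or]

lemma ominus_nonempty {γ : Finset (Finset A)} {α : Finset A} :
    ∀ β ∈ ominus γ α, β.Nonempty := by
  intro δ hδ
  obtain ⟨β, -, h1, rfl⟩ := mem_ominus_iff.1 hδ
  exact Finset.sdiff_nonempty.2 h1

lemma IE_union_aux (h : A → ℝ) (n : ℕ) : ∀ (γ₁ γ₂ : Finset (Finset A)),
    γ₁.card + γ₂.card ≤ n →
    (∀ β ∈ γ₁, β.Nonempty) → (∀ β ∈ γ₂, β.Nonempty) →
    (∀ a, a ∈ Act γ₁ → a ∉ Act γ₂) →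
    (IE (γ₁ ∪ γ₂) h ↔ IE γ₁ h ∧ IE γ₂ h) := by
  induction n with
  | zero =>
    intro γ₁ γ₂ hc _ _ _
    have h1 : γ₁ = ∅ := Finset.card_eq_zero.1 (by omega)
    have h2 : γ₂ = ∅ := Finset.card_eq_zero.1 (by omega)
    subst h1 h2
    simp
  | succ n ih =>
    have fwd : ∀ (γ₁ γ₂ : Finset (Finset A)), γ₁.card + γ₂.card ≤ n + 1 →
        (∀ β ∈ γ₁, β.Nonempty) → (∀ β ∈ γ₂, β.Nonempty) →
        (∀ a, a ∈ Act γ₁ → a ∉ Act γ₂) → ∀ α ∈ γ₁,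
        (∀ ai ∈ α, ∀ aj ∈ α, h ai = h aj) →
        (∀ ai ∈ α, ∀ ak ∈ Act (ominus (γ₁ ∪ γ₂) α), h ai ≤ h ak) →
        IE (ominus (γ₁ ∪ γ₂) α) h → IE γ₁ h ∧ IE γ₂ h := by
      intro γ₁ γ₂ hc hn1 hn2 hd α hα he hl hI
      rw [ominus_union_eq hn2 hd hα] at hl hI
      have hlt := ominus_card_lt hα
      obtain ⟨i1, i2⟩ := (ih _ _ (by omega) ominus_nonempty hn2
        (fun a ha => hd a (Act_ominus_sub ha))).1 hI
      refine ⟨?_, i2⟩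
      rw [IE]
      exact Or.inr ⟨α, hα, he, fun ai hi ak hk => hl ai hi ak (Act_union_iff.2 (Or.inl hk)), i1⟩
    have bwd : ∀ (γ₁ γ₂ : Finset (Finset A)), γ₁.card + γ₂.card ≤ n + 1 →
        (∀ β ∈ γ₁, β.Nonempty) → (∀ β ∈ γ₂, β.Nonempty) →
        (∀ a, a ∈ Act γ₁ → a ∉ Act γ₂) → ∀ α ∈ γ₁,
        (∀ ai ∈ α, ∀ aj ∈ α, h ai = h aj) →
        (∀ ai ∈ α, ∀ ak ∈ Act (ominus γ₁ α), h ai ≤ h ak) →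
        (∀ ai ∈ α, ∀ ak ∈ Act γ₂, h ai ≤ h ak) →
        IE (ominus γ₁ α) h → IE γ₂ h → IE (γ₁ ∪ γ₂) h := by
      intro γ₁ γ₂ hc hn1 hn2 hd α hα he hl hl2 i1 i2
      have hlt := ominus_card_lt hα
      rw [IE]
      refine Or.inr ⟨α, Finset.mem_union_left _ hα, he, ?_, ?_⟩
      · rw [ominus_union_eq hn2 hd hα]
        intro ai hi ak hk
        rcases Act_union_iff.1 hk with hk | hk
        · exact hl ai hi ak hk
        · exact hl2 ai hi ak hk
      · rw [ominus_union_eq hn2 hd hα]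
        exact (ih _ _ (by omega) ominus_nonempty hn2
          (fun a ha => hd a (Act_ominus_sub ha))).2 ⟨i1, i2⟩
    intro γ₁ γ₂ hc hn1 hn2 hd
    have hd' : ∀ a, a ∈ Act γ₂ → a ∉ Act γ₁ := fun a h2 h1 => hd a h1 h2
    constructor
    · intro hI
      rw [IE] at hI
      rcases hI with h0 | ⟨α, hα, he, hl, hI⟩
      · obtain ⟨h1, h2⟩ := Finset.union_eq_empty.1 h0
        rw [IE, IE]
        exact ⟨Or.inl h1, Or.inl h2⟩
      · rcases Finset.mem_union.1 hα with hα | hα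
        · exact fwd γ₁ γ₂ hc hn1 hn2 hd α hα he hl hI
        · rw [Finset.union_comm] at hl hI
          exact (fwd γ₂ γ₁ (by omega) hn2 hn1 hd' α hα he hl hI).symm
    · rintro ⟨I1, I2⟩
      have J1 := I1
      have J2 := I2
      rw [IE] at J1 J2
      rcases J1 with h0 | ⟨α, hα, he, hl, i1⟩
      · rw [h0, Finset.empty_union]
        exact I2
      rcases J2 with h0 | ⟨α', hα', he', hl', i2⟩
      · rw [h0, Finset.union_empty]
        exact I1
      obtain ⟨x, hx⟩ := hn1 α hα
      obtain ⟨y, hy⟩ := hn2 α' hα'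
      rcases le_total (h x) (h y) with hxy | hxy
      · refine bwd γ₁ γ₂ hc hn1 hn2 hd α hα he hl ?_ i1 I2
        intro ai hi ak hk
        rw [he ai hi x hx]
        refine hxy.trans ?_
        rcases Act_cases (α := α') hk with hk | hk
        · exact (he' y hy ak hk).le
        · exact hl' y hy ak hk
      · rw [Finset.union_comm]
        refine bwd γ₂ γ₁ (by omega) hn2 hn1 hd' α' hα' he' hl' ?_ i2 I1
        intro ai hi ak hk
        rw [he' ai hi y hy]
        refine hxy.trans ?_
        rcases Act_cases (α := α) hk with hk | hk
        · exact (he x hx ak hk).le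
        · exact hl x hx ak hk

/-- if Act(γ₁) ∩ Act(γ₂) = ∅ then ℰ(γ₁ ∪ γ₂) ≡ ℰ(γ₁) ∧ ℰ(γ₂). -/
theorem IE_union_of_disjoint_acts (γ₁ γ₂ : Finset (Finset A))
    (hγ₁ : ∀ β ∈ γ₁, β.Nonempty) (hγ₂ : ∀ β ∈ γ₂, β.Nonempty)
    (hdisj : Act γ₁ ∩ Act γ₂ = ∅) (h : A → ℝ) :
    IE (γ₁ ∪ γ₂) h ↔ IE γ₁ h ∧ IE γ₂ h := by
  refine IE_union_aux h _ γ₁ γ₂ le_rfl hγ₁ hγ₂ ?_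
  intro a h1 h2
  have h3 : a ∈ Act γ₁ ∩ Act γ₂ := Finset.mem_inter.2 ⟨h1, h2⟩
  rw [hdisj] at h3
  exact absurd h3 (Finset.notMem_empty a)
end

section
/- Let γ be a finite set of interactions, h : A → ℝ a history-clock valuation with h a ≥ 0 for all a, and α ∈ γ. If ℰ(γ)(h) holds, then ℰ(γ)(h') also holds, where h' is the valuation obtained from h by resetting to 0 the clocks of the actions of α, i.e., h' a = 0 if a ∈ α and h' a = h a otherwise. (This is the discrete-step case in the proof that ℰ(γ) is an inductive predicate of the system with history clocks.) -/
variable {A : Type*} [DecidableEq A]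

lemma mem_Act_ominus {γ : Finset (Finset A)} {X : Finset A} {a : A} :
    a ∈ Act (ominus γ X) ↔ a ∈ Act γ ∧ a ∉ X := by
  simp only [mem_Act_iff, ominus, Finset.mem_image, Finset.mem_filter]
  constructor
  · rintro ⟨_, ⟨δ, ⟨hδ, _⟩, rfl⟩, ha⟩
    rw [Finset.mem_sdiff] at ha
    exact ⟨⟨δ, hδ, ha.1⟩, ha.2⟩
  · rintro ⟨⟨δ, hδ, ha⟩, hX⟩
    exact ⟨δ \ X, ⟨δ, ⟨hδ, fun hs => hX (hs ha)⟩, rfl⟩, Finset.mem_sdiff.mpr ⟨ha, hX⟩⟩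

lemma ominus_ominus (γ : Finset (Finset A)) (X Y : Finset A) :
    ominus (ominus γ X) Y = ominus γ (X ∪ Y) := by
  have key : ∀ δ : Finset A, (δ \ X) \ Y = δ \ (X ∪ Y) := fun δ => by
    ext a; simp only [Finset.mem_sdiff, Finset.mem_union]; tauto
  have key2 : ∀ δ : Finset A, δ \ X ⊆ Y ↔ δ ⊆ X ∪ Y := fun δ => by
    simp only [Finset.subset_iff, Finset.mem_sdiff, Finset.mem_union]
    exact forall_congr' fun a => by tauto
  ext ε
  simp only [ominus, Finset.mem_image, Finset.mem_filter]
  constructor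
  · rintro ⟨_, ⟨⟨δ, ⟨hδ, _⟩, rfl⟩, h2⟩, rfl⟩
    exact ⟨δ, ⟨hδ, fun hs => h2 ((key2 δ).mpr hs)⟩, (key δ).symm⟩
  · rintro ⟨δ, ⟨hδ, h2⟩, rfl⟩
    exact ⟨δ \ X, ⟨⟨δ, ⟨hδ, fun hs => h2 (hs.trans Finset.subset_union_left)⟩, rfl⟩,
      fun hs => h2 ((key2 δ).mp hs)⟩, key δ⟩

lemma IE_congr (n : ℕ) : ∀ (γ : Finset (Finset A)) (h h' : A → ℝ), γ.card ≤ n →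
    (∀ a ∈ Act γ, h a = h' a) → IE γ h → IE γ h' := by
  induction n with
  | zero =>
    intro γ h h' hn _ _
    rw [IE]
    exact Or.inl (Finset.card_eq_zero.mp (Nat.le_zero.mp hn))
  | succ n ih =>
    intro γ h h' hn heq hE
    rw [IE] at hE ⊢
    rcases hE with hE | ⟨β, hβ, h1, h2, h3⟩
    · exact Or.inl hE
    · have e1 : ∀ a ∈ β, h a = h' a := fun a ha => heq a (mem_Act_iff.mpr ⟨β, hβ, ha⟩)
      have e2 : ∀ a ∈ Act (ominus γ β), h a = h' a := fun a ha => heq a (mem_Act_ominus.mp ha).1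
      refine Or.inr ⟨β, hβ, ?_, ?_, ?_⟩
      · intro a ha b hb
        rw [← e1 a ha, ← e1 b hb]
        exact h1 a ha b hb
      · intro a ha b hb
        rw [← e1 a ha, ← e2 b hb]
        exact h2 a ha b hb
      · have := ominus_card_lt hβ
        exact ih _ h h' (by omega) e2 h3

lemma IE_ominus (n : ℕ) : ∀ (γ : Finset (Finset A)) (h : A → ℝ) (X : Finset A), γ.card ≤ n →
    IE γ h → IE (ominus γ X) h := by
  induction n with
  | zero =>
    intro γ h X hn _
    rw [IE]
    left
    rw [Finset.card_eq_zero.mp (Nat.le_zero.mp hn)]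
    simp [ominus]
  | succ n ih =>
    intro γ h X hn hE
    rw [IE] at hE
    rcases hE with hE | ⟨β, hβ, h1, h2, h3⟩
    · rw [IE]
      left
      rw [hE]
      simp [ominus]
    · have hc := ominus_card_lt hβ
      have h4 := ih _ h X (by omega) h3
      rw [ominus_ominus] at h4
      by_cases hs : β ⊆ X
      · rwa [Finset.union_eq_right.mpr hs] at h4
      · have hu : X ∪ β \ X = β ∪ X := by
          rw [Finset.union_sdiff_self_eq_union, Finset.union_comm]
        rw [IE]
        refine Or.inr ⟨β \ X, ?_, ?_, ?_, ?_⟩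
        · exact Finset.mem_image.mpr ⟨β, Finset.mem_filter.mpr ⟨hβ, hs⟩, rfl⟩
        · intro a ha b hb
          exact h1 a (Finset.mem_sdiff.mp ha).1 b (Finset.mem_sdiff.mp hb).1
        · intro a ha b hb
          rw [ominus_ominus, hu, ← ominus_ominus, mem_Act_ominus] at hb
          exact h2 a (Finset.mem_sdiff.mp ha).1 b hb.1
        · rw [ominus_ominus, hu]
          exact h4

/-- resetting the history clocks of the actions of an interaction
α ∈ γ preserves ℰ(γ) (discrete-step case of inductiveness). -/
theorem IE_reset (γ : Finset (Finset A)) (hγ : ∀ β ∈ γ, β.Nonempty)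
    (h : A → ℝ) (hpos : ∀ a, h a ≥ 0) (α : Finset A) (hα : α ∈ γ)
    (hE : IE γ h) :
    IE γ (fun a => if a ∈ α then 0 else h a) := by
  rw [IE]
  refine Or.inr ⟨α, hα, ?_, ?_, ?_⟩
  · intro a ha b hb
    simp [ha, hb]
  · intro a ha b hb
    have hb' := (mem_Act_ominus.mp hb).2
    simp only [ha, hb', if_true, if_false]
    exact hpos b
  · refine IE_congr _ _ h _ le_rfl ?_ (IE_ominus _ γ h α le_rfl hE)
    intro a ha
    simp [(mem_Act_ominus.mp ha).2]
end
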